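/- arXiv:1601.02492 — 2 statements merged into one kernel-verified Lean document; each statement's English description precedes it below -/
import Mathlib

section
/- Let n ≥ 2, let v₁,…,v_n be unit vectors in ℝ^{n−1} with ⟨v_i,v_j⟩ = −1/(n−1) for i ≠ j and Σ_{i=1}^n v_i = 0, let t ∈ [0,1], and define the unit vectors u_i = √((t(n−1)+1)/n) · e_n + √(((n−1)/n)(1−t)) · v_i ∈ ℝ^n. Then, writing p = t(n−1)+1, one has the decomposition of the identity (1/p) Σ_{i=1}^n u_i u_i^* + (nt/p) Σ_{j=1}^{n−1} e_j e_j^* = I_n, where u u^* denotes the rank-one matrix x ↦ ⟨x,u⟩u. -/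
open scoped RealInnerProductSpace

/-- Cross terms vanish when summing the rank-one maps of the translates `a • e + b • v i` of a
centred family `v`. -/
theorem sum_inner_smul_add_of_sum_eq_zero {ι E : Type*} [Fintype ι] [NormedAddCommGroup E]
    [InnerProductSpace ℝ E] (v : ι → E) (hv : ∑ i, v i = 0) (e x : E) (a b : ℝ) :
    ∑ i, ⟪x, a • e + b • v i⟫ • (a • e + b • v i) =
      (Fintype.card ι * a ^ 2) • ⟪x, e⟫ • e + b ^ 2 • ∑ i, ⟪x, v i⟫ • v i := by
  have hx : ∑ i, ⟪x, v i⟫ = 0 := by rw [← inner_sum, hv, inner_zero_right]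
  have hterm (i : ι) : ⟪x, a • e + b • v i⟫ • (a • e + b • v i) =
      (a ^ 2 * ⟪x, e⟫) • e + (a * b * ⟪x, e⟫) • v i + ⟪x, v i⟫ • ((a * b) • e)
        + b ^ 2 • (⟪x, v i⟫ • v i) := by
    rw [inner_add_right, inner_smul_right, inner_smul_right]
    module
  simp_rw [hterm, Finset.sum_add_distrib, ← Finset.smul_sum, ← Finset.sum_smul, hv, hx]
  simp only [Finset.sum_const, Finset.card_univ, smul_zero, zero_smul]
  module

/-- The vertices of a regular simplex centred at the origin of the hyperplane `eᗮ` form a tight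
frame of that hyperplane. -/
theorem sum_inner_smul_simplex {ι E : Type*} [Fintype ι] [NormedAddCommGroup E]
    [InnerProductSpace ℝ E]
    (hcard : Fintype.card ι = Module.finrank ℝ E) (hι : 2 ≤ Fintype.card ι) (v : ι → E) (e : E)
    (he : ‖e‖ = 1) (hev : ∀ i, ⟪e, v i⟫ = 0) (hv_norm : ∀ i, ‖v i‖ = 1)
    (hv_inner : ∀ i j, i ≠ j → ⟪v i, v j⟫ = -1 / (Fintype.card ι - 1 : ℝ))
    (hv_sum : ∑ i, v i = 0) (x : E) :
    ((Fintype.card ι - 1 : ℝ) / Fintype.card ι) • ∑ i, ⟪x, v i⟫ • v i = x - ⟪x, e⟫ • e := by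
  set N : ℝ := (Fintype.card ι : ℝ) with hN
  have hN2 : 2 ≤ N := by rw [hN]; exact_mod_cast hι
  have hN0 : N ≠ 0 := by linarith
  have hN1 : N - 1 ≠ 0 := by linarith
  have ha : √(1 / N) ^ 2 = 1 / N := Real.sq_sqrt (by positivity)
  have hb : √((N - 1) / N) ^ 2 = (N - 1) / N :=
    Real.sq_sqrt (div_nonneg (by linarith) (by linarith))
  let w : ι → E := fun i ↦ √(1 / N) • e + √((N - 1) / N) • v i
  have hw (i j : ι) : ⟪w i, w j⟫ = 1 / N + (N - 1) / N * ⟪v i, v j⟫ := by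
    have hve : ⟪v i, e⟫ = 0 := by rw [real_inner_comm, hev]
    have hee : ⟪e, e⟫ = 1 := by rw [real_inner_self_eq_norm_sq, he, one_pow]
    simp only [w, inner_add_left, inner_add_right, real_inner_smul_left, real_inner_smul_right,
      hev, hve, hee]
    linear_combination ha + ⟪v i, v j⟫ * hb
  have hortho : Orthonormal ℝ w := by
    classical
    rw [orthonormal_iff_ite]
    intro i j
    rw [hw]
    split_ifs with h
    · subst h
      rw [real_inner_self_eq_norm_sq, hv_norm]
      field_simp
      ring
    · rw [hv_inner i j h]
      field_simp
      ring
  have : Nonempty ι := Fintype.card_pos_iff.mp (by omega)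
  have hspan : ⊤ ≤ Submodule.span ℝ (Set.range w) :=
    (hortho.linearIndependent.span_eq_top_of_card_eq_finrank hcard).ge
  have key := (OrthonormalBasis.mk hortho hspan).sum_repr' x
  simp only [OrthonormalBasis.coe_mk, real_inner_comm x] at key
  have h := sum_inner_smul_add_of_sum_eq_zero v hv_sum e x √(1 / N) √((N - 1) / N)
  rw [ha, hb, ← hN, mul_one_div_cancel hN0, one_smul] at h
  rw [eq_sub_iff_add_eq', ← h]
  exact key

theorem sr_simplex_identity_decomposition_pos (n : ℕ) (hn : 2 ≤ n)
    (v : Fin n → EuclideanSpace ℝ (Fin n))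
    -- the `v i` lie in `ℝ^{n-1}`, identified with the span of the first `n-1` basis vectors
    (hv_last : ∀ i, v i ⟨n - 1, by omega⟩ = 0)
    (hv_norm : ∀ i, ‖v i‖ = 1)
    (hv_inner : ∀ i j, i ≠ j → ⟪v i, v j⟫ = -1 / (n - 1 : ℝ))
    (hv_sum : ∑ i, v i = 0)
    (t : ℝ) (ht : t ∈ Set.Icc (0 : ℝ) 1)
    (u : Fin n → EuclideanSpace ℝ (Fin n))
    (hu : ∀ i, u i =
      Real.sqrt ((t * (n - 1) + 1) / n) • EuclideanSpace.single ⟨n - 1, by omega⟩ (1 : ℝ)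
        + Real.sqrt (((n - 1 : ℝ) / n) * (1 - t)) • v i)
    (p : ℝ) (hp : p = t * (n - 1) + 1) :
    -- `(1/p) Σᵢ uᵢuᵢ* + (nt/p) Σⱼ eⱼeⱼ* = Iₙ`, as linear maps `x ↦ ⟨x,u⟩u`
    ∀ x : EuclideanSpace ℝ (Fin n),
      (1 / p) • (∑ i, ⟪x, u i⟫ • u i)
        + ((n * t) / p) • (∑ j : Fin (n - 1),
            ⟪x, EuclideanSpace.single (Fin.castLE (Nat.sub_le n 1) j) (1 : ℝ)⟫ •
              EuclideanSpace.single (Fin.castLE (Nat.sub_le n 1) j) (1 : ℝ)) = x := by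
  intro x
  obtain ⟨m, rfl⟩ : ∃ m, n = m + 1 := ⟨n - 1, by omega⟩
  set e : EuclideanSpace ℝ (Fin (m + 1)) :=
    EuclideanSpace.single ⟨m + 1 - 1, by omega⟩ (1 : ℝ)
  set N : ℝ := ((m + 1 : ℕ) : ℝ) with hN
  have hN2 : 2 ≤ N := by rw [hN]; exact_mod_cast hn
  have hN0 : N ≠ 0 := by linarith
  have hp1 : 0 < p := by
    have := mul_nonneg ht.1 (by linarith : 0 ≤ N - 1)
    linarith
  have hframe := sum_inner_smul_simplex (by simp) (by simpa using hn) v e (by simp [e])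
    (fun i ↦ by simpa [e, EuclideanSpace.inner_single_left] using hv_last i) hv_norm
    (by simpa only [Fintype.card_fin] using hv_inner) hv_sum x
  have hstd : ∑ j : Fin (m + 1 - 1),
      ⟪x, EuclideanSpace.single (Fin.castLE (Nat.sub_le (m + 1) 1) j) (1 : ℝ)⟫ •
        EuclideanSpace.single (Fin.castLE (Nat.sub_le (m + 1) 1) j) (1 : ℝ) = x - ⟪x, e⟫ • e := by
    have h := (EuclideanSpace.basisFun (Fin (m + 1)) ℝ).sum_repr' x
    simp only [EuclideanSpace.basisFun_apply, real_inner_comm x, Fin.sum_univ_castSucc] at h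
    exact eq_sub_of_add_eq h
  have ha : √((t * (N - 1) + 1) / N) ^ 2 = p / N := by
    rw [← hp]
    exact Real.sq_sqrt (div_nonneg hp1.le (by linarith))
  have hb : √((N - 1) / N * (1 - t)) ^ 2 = (1 - t) * ((N - 1) / N) := by
    rw [mul_comm (1 - t)]
    exact Real.sq_sqrt (mul_nonneg (div_nonneg (by linarith) (by linarith)) (by linarith [ht.2]))
  simp only [Fintype.card_fin, ← hN] at hframe
  rw [hstd]
  simp_rw [hu]
  rw [sum_inner_smul_add_of_sum_eq_zero v hv_sum e x, ha, hb, mul_smul (1 - t), hframe,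
    Fintype.card_fin, ← hN, mul_div_cancel₀ p hN0]
  have hcoef : 1 / p * (1 - t) + N * t / p = 1 := by
    field_simp
    linarith
  have hinv : 1 / p * p = 1 := one_div_mul_cancel hp1.ne'
  linear_combination (norm := module) hinv • (⟪x, e⟫ • e) + hcoef • (x - ⟪x, e⟫ • e)
end

section
/- Let n ≥ 2, let v₁,…,v_n be unit vectors in ℝ^{n−1} with ⟨v_i,v_j⟩ = −1/(n−1) for i ≠ j and Σ_{i=1}^n v_i = 0, let t ∈ [−1/(n−1), 0], and define the unit vectors u_i = √((t(n−1)+1)/n) · e_n + √(((n−1)/n)(1−t)) · v_i ∈ ℝ^n. Then (1/(1−t)) Σ_{i=1}^n u_i u_i^* + (−nt/(1−t)) e_n e_n^* = I_n, where u u^* denotes the rank-one matrix x ↦ ⟨x,u⟩u. -/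
open scoped RealInnerProductSpace

section

variable {ι E : Type*} [Fintype ι] [NormedAddCommGroup E] [InnerProductSpace ℝ E]

/-- The frame operator of the translated and scaled family `α • e + β • v i`, for a family `v`
with vanishing sum. -/
theorem sum_inner_smul_add_smul_of_sum_eq_zero (v : ι → E) (hv : ∑ i, v i = 0) (e x : E)
    (α β : ℝ) :
    ∑ i, ⟪x, α • e + β • v i⟫ • (α • e + β • v i) =
      (Fintype.card ι * α ^ 2 * ⟪x, e⟫) • e + β ^ 2 • ∑ i, ⟪x, v i⟫ • v i := by
  have hx : ∑ i, ⟪x, v i⟫ = 0 := by rw [← inner_sum, hv, inner_zero_right]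
  have hterm (i : ι) : ⟪x, α • e + β • v i⟫ • (α • e + β • v i) =
      (α ^ 2 * ⟪x, e⟫) • e + (α * β * ⟪x, e⟫) • v i + ⟪x, v i⟫ • ((α * β) • e)
        + β ^ 2 • (⟪x, v i⟫ • v i) := by
    rw [inner_add_right, inner_smul_right, inner_smul_right]
    module
  simp_rw [hterm, Finset.sum_add_distrib, ← Finset.smul_sum, ← Finset.sum_smul, hv, hx]
  simp only [Finset.sum_const, Finset.card_univ, smul_zero, zero_smul, add_zero,
    ← Nat.cast_smul_eq_nsmul ℝ]
  module

/-- An orthonormal family of as many vectors as the dimension satisfies Parseval's identity. -/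
theorem Orthonormal.sum_inner_smul_eq_of_card_eq_finrank [FiniteDimensional ℝ E] {w : ι → E}
    (hw : Orthonormal ℝ w) (hcard : Fintype.card ι = Module.finrank ℝ E) (x : E) :
    ∑ i, ⟪x, w i⟫ • w i = x := by
  have hspan := hw.linearIndependent.span_eq_top_of_card_eq_finrank' hcard
  simpa [real_inner_comm] using (OrthonormalBasis.mk hw hspan.ge).sum_repr' x

/-- The frame operator of a regular simplex spanning the orthogonal complement of a unit
vector `e`. -/
theorem sum_inner_smul_of_regular_simplex [FiniteDimensional ℝ E] {n : ℕ} (hn : 2 ≤ n)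
    (hfin : Module.finrank ℝ E = n) (v : Fin n → E) (e : E) (he : ‖e‖ = 1)
    (hev : ∀ i, ⟪e, v i⟫ = 0) (hv_norm : ∀ i, ‖v i‖ = 1)
    (hv_inner : ∀ i j, i ≠ j → ⟪v i, v j⟫ = -1 / (n - 1 : ℝ)) (hv_sum : ∑ i, v i = 0) (x : E) :
    ((n - 1 : ℝ) / n) • ∑ i, ⟪x, v i⟫ • v i = x - ⟪x, e⟫ • e := by
  have hn' : (2 : ℝ) ≤ n := by exact_mod_cast hn
  have hn0 : (n : ℝ) ≠ 0 := by positivity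
  have hn1 : (n : ℝ) - 1 ≠ 0 := by linarith
  have hα : √(1 / n : ℝ) ^ 2 = 1 / n := Real.sq_sqrt (by positivity)
  have hβ : √((n - 1 : ℝ) / n) ^ 2 = (n - 1) / n :=
    Real.sq_sqrt (div_nonneg (by linarith) (by positivity))
  set α := √(1 / n : ℝ)
  set β := √((n - 1 : ℝ) / n)
  have hee : ⟪e, e⟫ = 1 := by rw [real_inner_self_eq_norm_sq, he, one_pow]
  have hinner (i j : Fin n) :
      ⟪α • e + β • v i, α • e + β • v j⟫ = 1 / n + (n - 1) / n * ⟪v i, v j⟫ := by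
    simp only [inner_add_left, inner_add_right, real_inner_smul_left, real_inner_smul_right,
      hee, hev, real_inner_comm e]
    rw [← hα, ← hβ]
    ring
  have hw : Orthonormal ℝ fun i => α • e + β • v i := by
    classical
    rw [orthonormal_iff_ite]
    intro i j
    rw [hinner]
    split_ifs with h
    · subst h
      rw [real_inner_self_eq_norm_sq, hv_norm]
      field_simp
      ring
    · rw [hv_inner i j h]
      field_simp
      ring
  have key := hw.sum_inner_smul_eq_of_card_eq_finrank (by simp [hfin]) x
  rw [sum_inner_smul_add_smul_of_sum_eq_zero v hv_sum, hα, hβ, Fintype.card_fin,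
    mul_one_div_cancel hn0, one_mul] at key
  exact eq_sub_of_add_eq' key

end

theorem sr_simplex_identity_decomposition_neg (n : ℕ) (hn : 2 ≤ n)
    (v : Fin n → EuclideanSpace ℝ (Fin n))
    -- the `v i` lie in `ℝ^{n-1}`, identified with the span of the first `n-1` basis vectors
    (hv_last : ∀ i, v i ⟨n - 1, by omega⟩ = 0)
    (hv_norm : ∀ i, ‖v i‖ = 1)
    (hv_inner : ∀ i j, i ≠ j → ⟪v i, v j⟫ = -1 / (n - 1 : ℝ))
    (hv_sum : ∑ i, v i = 0)
    (t : ℝ) (ht : t ∈ Set.Icc (-1 / (n - 1 : ℝ)) 0)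
    (u : Fin n → EuclideanSpace ℝ (Fin n))
    (hu : ∀ i, u i =
      Real.sqrt ((t * (n - 1) + 1) / n) • EuclideanSpace.single ⟨n - 1, by omega⟩ (1 : ℝ)
        + Real.sqrt (((n - 1 : ℝ) / n) * (1 - t)) • v i) :
    -- `(1/(1-t)) Σᵢ uᵢuᵢ* + (-nt/(1-t)) eₙeₙ* = Iₙ`, as linear maps `x ↦ ⟨x,u⟩u`
    ∀ x : EuclideanSpace ℝ (Fin n),
      (1 / (1 - t)) • (∑ i, ⟪x, u i⟫ • u i)
        + ((-(n * t)) / (1 - t)) •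
            (⟪x, EuclideanSpace.single (⟨n - 1, by omega⟩ : Fin n) (1 : ℝ)⟫ •
              EuclideanSpace.single (⟨n - 1, by omega⟩ : Fin n) (1 : ℝ)) = x := by
  intro x
  obtain ⟨ht1, ht0⟩ := ht
  have hn' : (2 : ℝ) ≤ n := by exact_mod_cast hn
  have hn1 : (0 : ℝ) < n - 1 := by linarith
  have h1t : 1 - t ≠ 0 := by linarith
  rw [div_le_iff₀ hn1] at ht1
  simp_rw [hu]
  set e : EuclideanSpace ℝ (Fin n) := EuclideanSpace.single ⟨n - 1, by omega⟩ (1 : ℝ) with he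
  have hsimplex := sum_inner_smul_of_regular_simplex hn (by simp) v e (by simp [he])
    (fun i => by simp [he, EuclideanSpace.inner_single_left, hv_last]) hv_norm hv_inner hv_sum x
  rw [sum_inner_smul_add_smul_of_sum_eq_zero v hv_sum,
    Real.sq_sqrt (div_nonneg (by linarith) (by positivity)),
    Real.sq_sqrt (mul_nonneg (by positivity) (by linarith)), Fintype.card_fin,
    mul_div_cancel₀ _ (by positivity), mul_comm ((n - 1 : ℝ) / n), mul_smul (1 - t), hsimplex]
  match_scalars <;> field_simp
  ring
end
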